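/- Quantitative equivalence of ensembles (Theorem A.1): assume in addition that g is nondecreasing and uniformly Lipschitz (there is g₂* with |g(k+1) − g(k)| ≤ g₂* for all k) and satisfies the gap condition. Fix 0 < m₀ < m₁. Then for every ε > 0 there exists a constant C > 0 such that for every finite index set Λ of cardinality L ≥ 1, every distinguished site y₀ ∈ Λ, every M ∈ ℕ and every λ > 0 satisfying R(λ) = M/L and m₀ ≤ M/L ≤ m₁, one has | ( Σ_{η ∈ ℕ^Λ : Σ_{y∈Λ} η_y = M} g(η_{y₀}) Π_{y∈Λ} 1/g(η_y)! ) / ( Σ_{η ∈ ℕ^Λ : Σ_{y∈Λ} η_y = M} Π_{y∈Λ} 1/g(η_y)! ) − λ | ≤ C L^{−1+ε}. (Both sums run over the finite set of configurations with total particle number M; the quotient is the expectation of g(η_{y₀}) under the canonical measure, and λ is the expectation of g(η_{y₀}) under the grand-canonical product measure with mean density M/L.) -/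

import Mathlib

open Finset Real

/-- `gFact g k = g(k)! := g(1)g(2)⋯g(k)`, with `g(0)! = 1`. -/
noncomputable def gFact (g : ℕ → ℝ) : ℕ → ℝ
  | 0 => 1
  | k + 1 => gFact g k * g (k + 1)

/-- The partition function `Z(λ) = Σ_k λ^k / g(k)!`. -/
noncomputable def Zfun (g : ℕ → ℝ) (l : ℝ) : ℝ := ∑' k : ℕ, l ^ k / gFact g k

/-- The mean density `R(λ) = Σ_k k λ^k / (g(k)! Z(λ))`. -/
noncomputable def Rfun (g : ℕ → ℝ) (l : ℝ) : ℝ :=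
  ∑' k : ℕ, (k : ℝ) * l ^ k / (gFact g k * Zfun g l)

/-- The one-site equilibrium weight `n_λ(k) = λ^k / (g(k)! Z(λ))`. -/
noncomputable def nWeight (g : ℕ → ℝ) (l : ℝ) (k : ℕ) : ℝ := l ^ k / (gFact g k * Zfun g l)

/-- The gap condition on the jump rate `g`: there are `n₀` and `c_g > 0` with
`g(n') − g(n) ≥ c_g` whenever `n' ≥ n + n₀`. -/
def GapCondition (g : ℕ → ℝ) : Prop :=
  ∃ n₀ : ℕ, ∃ cg : ℝ, 0 < cg ∧ ∀ n n' : ℕ, n + n₀ ≤ n' → cg ≤ g n' - g n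

theorem norm_pow_sub_re_pow_le (z : ℂ) (n : ℕ) :
    ‖z ^ n - (z.re : ℂ) ^ n‖ ≤ n * ‖z‖ ^ (n - 1) * |z.im| := by
  have hre : ‖(z.re : ℂ)‖ ≤ ‖z‖ := by simpa using Complex.abs_re_le_norm z
  have hsub : ‖z - (z.re : ℂ)‖ = |z.im| := by
    have h : z - (z.re : ℂ) = z.im * Complex.I := by
      linear_combination -(Complex.re_add_im z)
    simp [h]
  rw [← Commute.geom_sum₂_mul (Commute.all z _) n, norm_mul, hsub]
  refine mul_le_mul_of_nonneg_right ?_ (abs_nonneg _)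
  calc ‖∑ i ∈ range n, z ^ i * (z.re : ℂ) ^ (n - 1 - i)‖
      ≤ ∑ i ∈ range n, ‖z‖ ^ (n - 1) := by
        refine norm_sum_le_of_le _ fun i hi => ?_
        rw [norm_mul, norm_pow, norm_pow]
        have hi' : n - 1 = i + (n - 1 - i) := by have := mem_range.1 hi; omega
        calc ‖z‖ ^ i * ‖(z.re : ℂ)‖ ^ (n - 1 - i) ≤ ‖z‖ ^ i * ‖z‖ ^ (n - 1 - i) := by gcongr
          _ = ‖z‖ ^ (n - 1) := by rw [← pow_add, ← hi']
    _ = n * ‖z‖ ^ (n - 1) := by simp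

theorem exists_pow_mul_exp_neg_sq_le {c : ℝ} (hc : 0 < c) (k : ℕ) :
    ∃ C > 0, ∀ u : ℝ, 0 ≤ u → u ^ k * exp (-(2 * c) * u ^ 2) ≤ C * exp (-c * u ^ 2) := by
  refine ⟨1 + k.factorial / c ^ k, by positivity, fun u hu => ?_⟩
  have h1 : u ^ k ≤ 1 + (u ^ 2) ^ k := by
    rw [← pow_mul, mul_comm 2 k, pow_mul]
    nlinarith [sq_nonneg (u ^ k - 1 / 2)]
  have h2 : (u ^ 2) ^ k ≤ k.factorial / c ^ k * exp (c * u ^ 2) := by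
    have h := pow_div_factorial_le_exp (c * u ^ 2) (by positivity) k
    rw [mul_pow, div_le_iff₀ (by positivity)] at h
    rw [div_mul_eq_mul_div, le_div_iff₀ (by positivity)]
    linarith
  have h3 : (1 : ℝ) ≤ exp (c * u ^ 2) := one_le_exp (by positivity)
  have h4 : exp (-c * u ^ 2) = exp (c * u ^ 2) * exp (-(2 * c) * u ^ 2) := by
    rw [← exp_add]; ring_nf
  rw [h4, ← mul_assoc]
  gcongr
  linarith

theorem integral_exp_neg_mul_sq_le {b : ℝ} (hb : 0 < b) (r : ℝ) (hr : 0 ≤ r) :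
    ∫ t in (-r)..r, exp (-b * t ^ 2) ≤ √(π / b) := by
  rw [← integral_gaussian, intervalIntegral.integral_of_le (by linarith)]
  exact MeasureTheory.setIntegral_le_integral (integrable_exp_neg_mul_sq hb)
    (Filter.Eventually.of_forall fun _ => (exp_pos _).le)

set_option maxHeartbeats 1000000 in
/-- A comparison between Fourier integrals of the `n`-th power of a function which behaves like the
characteristic function of a centred lattice distribution. -/
theorem exists_fourier_integral_ratio_bound {c T K : ℝ} (hc : 0 < c) (hT : 0 < T) (hK : 1 ≤ K) :
    ∃ C > 0, ∃ N : ℕ, ∀ n : ℕ, N ≤ n → ∀ ψ : ℝ → ℂ, Continuous ψ →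
      (∀ t, |t| ≤ π → ‖ψ t‖ ≤ exp (-c * t ^ 2)) →
      (∀ t, |t| ≤ π → |(ψ t).im| ≤ T * |t| ^ 3) →
      (∀ t, |t| ≤ π → 1 - K * t ^ 2 ≤ (ψ t).re) →
      0 < ∫ t in (-π)..π, (ψ t ^ n).re ∧
      |∫ t in (-π)..π, (ψ t ^ n * (1 - Complex.exp (t * Complex.I))).re| ≤
        C / n * ∫ t in (-π)..π, (ψ t ^ n).re := by
  obtain ⟨b, hb, hbc⟩ : ∃ b > 0, 4 * b = c := ⟨c / 4, by positivity, by ring⟩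
  obtain ⟨A₂, hA₂, h₂⟩ := exists_pow_mul_exp_neg_sq_le hb 2
  obtain ⟨A₃, hA₃, h₃⟩ := exists_pow_mul_exp_neg_sq_le hb 3
  obtain ⟨A₄, hA₄, h₄⟩ := exists_pow_mul_exp_neg_sq_le hb 4
  have hK0 : 0 < K := by linarith
  set G : ℝ := √(π / b) with hG
  have hGpos : 0 < G := by positivity
  set κ : ℝ := 1 / (2 * √(2 * K)) with hκ
  have hκpos : 0 < κ := by positivity
  set B : ℝ := T * A₃ + K ^ 2 * A₄ with hB
  have hBpos : 0 < B := by positivity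
  set D : ℝ := A₂ / 2 + T * A₄ with hD
  have hDpos : 0 < D := by positivity
  obtain ⟨N, hN⟩ := exists_nat_ge ((B * G / κ) ^ 2)
  refine ⟨D * G / κ, by positivity, max N 2, fun n hn ψ hψ hnorm him hre => ?_⟩
  have hn2 : 2 ≤ n := le_trans (le_max_right _ _) hn
  have hnN : N ≤ n := le_trans (le_max_left _ _) hn
  have hn2' : (2 : ℝ) ≤ n := by exact_mod_cast hn2
  obtain ⟨s, hs0, hs⟩ : ∃ s : ℝ, 0 < s ∧ s ^ 2 = n :=
    ⟨√n, by positivity, sq_sqrt (by positivity)⟩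
  have hs1 : 1 ≤ s := by nlinarith
  have hsB : B * G ≤ κ * s := by
    have h : B * G / κ ≤ s := by
      refine le_of_sq_le_sq ?_ hs0.le
      rw [hs]; exact hN.trans (by exact_mod_cast hnN)
    rw [div_le_iff₀ hκpos] at h
    linarith
  -- Gaussian decay of the powers of `ψ`, in the scaled variable `s * |t|`
  have hpow : ∀ t, |t| ≤ π → ‖ψ t‖ ^ (n - 1) ≤ exp (-(2 * b) * (s * |t|) ^ 2) := by
    intro t ht
    calc ‖ψ t‖ ^ (n - 1) ≤ exp (-c * t ^ 2) ^ (n - 1) := by gcongr; exact hnorm t ht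
      _ = exp ((n - 1 : ℕ) * (-c * t ^ 2)) := by rw [← exp_nat_mul]
      _ ≤ _ := by
        rw [exp_le_exp, Nat.cast_sub (by omega), mul_pow, hs, sq_abs, ← hbc]
        push_cast
        nlinarith [mul_nonneg hb.le (sq_nonneg t), mul_nonneg (mul_nonneg hb.le (sq_nonneg t))
          (sub_nonneg.2 hn2')]
  have hle1 : ∀ t, |t| ≤ π → ‖ψ t‖ ≤ 1 := fun t ht =>
    (hnorm t ht).trans (exp_le_one_iff.2 (by nlinarith [mul_nonneg hc.le (sq_nonneg t)]))
  have hpow' : ∀ t, |t| ≤ π → ‖ψ t‖ ^ n ≤ exp (-(2 * b) * (s * |t|) ^ 2) := fun t ht =>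
    (pow_le_pow_of_le_one (norm_nonneg _) (hle1 t ht) (by omega)).trans (hpow t ht)
  have hdiff : ∀ t, |t| ≤ π → ‖ψ t ^ n - ((ψ t).re : ℂ) ^ n‖ ≤
      n * exp (-(2 * b) * (s * |t|) ^ 2) * (T * |t| ^ 3) := by
    intro t ht
    refine (norm_pow_sub_re_pow_le _ _).trans ?_
    gcongr
    · exact hpow t ht
    · exact him t ht
  have hscale : ∀ t : ℝ, exp (-b * (s * |t|) ^ 2) = exp (-(b * n) * t ^ 2) := by
    intro t; rw [mul_pow, hs, sq_abs]; ring_nf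
  have hint : ∫ t in (-π)..π, exp (-(b * n) * t ^ 2) ≤ G / s := by
    refine (integral_exp_neg_mul_sq_le (by positivity) π pi_pos.le).trans_eq ?_
    rw [hG, ← hs, ← div_div, sqrt_div' _ (by positivity), sqrt_sq hs0.le]
  -- upper bound for the difference
  have hupper : ∀ t, |t| ≤ π → |(ψ t ^ n * (1 - Complex.exp (t * Complex.I))).re| ≤
      D / n * exp (-(b * n) * t ^ 2) := by
    intro t ht
    have e1 : (ψ t ^ n * (1 - Complex.exp (t * Complex.I))).re =
        (ψ t ^ n).re * (1 - cos t) + (ψ t ^ n).im * sin t := by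
      rw [Complex.mul_re, Complex.sub_re, Complex.sub_im, Complex.exp_ofReal_mul_I_re,
        Complex.exp_ofReal_mul_I_im]
      simp
    have e2 : |(ψ t ^ n).re| ≤ exp (-(2 * b) * (s * |t|) ^ 2) :=
      (Complex.abs_re_le_norm _).trans (by rw [norm_pow]; exact hpow' t ht)
    have e3 : |(ψ t ^ n).im| ≤ n * exp (-(2 * b) * (s * |t|) ^ 2) * (T * |t| ^ 3) := by
      refine le_trans ?_ (hdiff t ht)
      have h := Complex.abs_im_le_norm (ψ t ^ n - ((ψ t).re : ℂ) ^ n)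
      rwa [Complex.sub_im, ← Complex.ofReal_pow, Complex.ofReal_im, sub_zero,
        Complex.ofReal_pow] at h
    have e4 : |1 - cos t| ≤ t ^ 2 / 2 := by
      rw [abs_of_nonneg (by linarith [cos_le_one t])]
      linarith [one_sub_sq_div_two_le_cos (x := t)]
    have e5 : |sin t| ≤ |t| := abs_sin_le_abs
    have e6 := h₂ (s * |t|) (by positivity)
    have e7 := h₄ (s * |t|) (by positivity)
    rw [hscale] at e6 e7
    set E := exp (-(2 * b) * (s * |t|) ^ 2)
    set F := exp (-(b * n) * t ^ 2)
    rw [e1]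
    calc |(ψ t ^ n).re * (1 - cos t) + (ψ t ^ n).im * sin t|
        ≤ |(ψ t ^ n).re| * |1 - cos t| + |(ψ t ^ n).im| * |sin t| := by
          rw [← abs_mul, ← abs_mul]; exact abs_add_le _ _
      _ ≤ E * (t ^ 2 / 2) + n * E * (T * |t| ^ 3) * |t| := by gcongr
      _ = (((s * |t|) ^ 2 * E) / 2 + T * ((s * |t|) ^ 4 * E)) / n := by
          rw [← sq_abs t, ← hs]; field_simp
      _ ≤ (A₂ * F / 2 + T * (A₄ * F)) / n := by gcongr
      _ = D / n * F := by rw [hD]; ring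
  -- lower bound for the main term
  have hlower : ∀ t, |t| ≤ π → (if K * t ^ 2 ≤ 1 then (1 - K * t ^ 2) ^ n else 0) ≤
      (ψ t ^ n).re + B / s * exp (-(b * n) * t ^ 2) := by
    intro t ht
    have e3 : ((ψ t).re) ^ n - (ψ t ^ n).re ≤
        n * exp (-(2 * b) * (s * |t|) ^ 2) * (T * |t| ^ 3) := by
      refine le_trans ?_ (hdiff t ht)
      have h := (abs_le.1 (Complex.abs_re_le_norm (ψ t ^ n - ((ψ t).re : ℂ) ^ n))).1
      rw [Complex.sub_re, ← Complex.ofReal_pow, Complex.ofReal_re] at h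
      rw [← Complex.ofReal_pow]
      linarith
    have e6 := h₃ (s * |t|) (by positivity)
    have e7 := h₄ (s * |t|) (by positivity)
    have e8 := hpow' t ht
    rw [hscale] at e6 e7
    set E := exp (-(2 * b) * (s * |t|) ^ 2)
    set F := exp (-(b * n) * t ^ 2)
    have e9 : n * E * (T * |t| ^ 3) ≤ T * A₃ / s * F := by
      calc n * E * (T * |t| ^ 3) = T * ((s * |t|) ^ 3 * E) / s := by rw [← hs]; field_simp
        _ ≤ T * (A₃ * F) / s := by gcongr
        _ = _ := by ring
    have e10 : 0 ≤ K ^ 2 * A₄ / s * F := by positivity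
    have e11 : B / s * F = T * A₃ / s * F + K ^ 2 * A₄ / s * F := by rw [hB]; ring
    split_ifs with h
    · have : (1 - K * t ^ 2) ^ n ≤ (ψ t).re ^ n :=
        pow_le_pow_left₀ (by linarith) (hre t ht) n
      linarith
    · have e12 : -E ≤ (ψ t).re ^ n := by
        refine (abs_le.1 ?_).1
        rw [abs_pow]
        exact (pow_le_pow_left₀ (abs_nonneg _) (Complex.abs_re_le_norm _) n).trans e8
      have e13 : E ≤ K ^ 2 * A₄ / s * F := by
        have hKt : 1 ≤ (K * t ^ 2) ^ 2 := one_le_pow₀ (by linarith)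
        calc E ≤ (K * t ^ 2) ^ 2 * E := le_mul_of_one_le_left (exp_pos _).le hKt
          _ = K ^ 2 * ((s * |t|) ^ 4 * E) / s ^ 4 := by
              rw [← sq_abs t]; field_simp
          _ ≤ K ^ 2 * (A₄ * F) / s := by
              gcongr
              exact le_self_pow₀ hs1 (by norm_num)
          _ = _ := by ring
      linarith
  have habs : ∀ t ∈ Set.Icc (-π) π, |t| ≤ π := fun t ht => abs_le.2 ht
  have hFi : ∀ x y, IntervalIntegrable (fun t : ℝ => exp (-(b * n) * t ^ 2))
      MeasureTheory.volume x y := fun x y => by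
    apply Continuous.intervalIntegrable; fun_prop
  have hψi : ∀ x y, IntervalIntegrable (fun t : ℝ => (ψ t ^ n).re)
      MeasureTheory.volume x y := fun x y => by
    apply Continuous.intervalIntegrable; fun_prop
  have hJ : |∫ t in (-π)..π, (ψ t ^ n * (1 - Complex.exp (t * Complex.I))).re| ≤
      D / n * (G / s) := by
    calc _ ≤ ∫ t in (-π)..π, |(ψ t ^ n * (1 - Complex.exp (t * Complex.I))).re| :=
          intervalIntegral.abs_integral_le_integral_abs (by linarith [pi_pos])
      _ ≤ ∫ t in (-π)..π, D / n * exp (-(b * n) * t ^ 2) := by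
          refine intervalIntegral.integral_mono_on (by linarith [pi_pos]) ?_
            ((hFi _ _).const_mul _) fun t ht => hupper t (habs t ht)
          apply Continuous.intervalIntegrable; fun_prop
      _ = D / n * ∫ t in (-π)..π, exp (-(b * n) * t ^ 2) := by
          rw [intervalIntegral.integral_const_mul]
      _ ≤ _ := by gcongr
  have hI : κ / s ≤ ∫ t in (-π)..π, (ψ t ^ n).re := by
    set δ : ℝ := 1 / (√(2 * K) * s) with hδ
    have hδpos : 0 < δ := by positivity
    have hδsq : δ ^ 2 = 1 / (2 * K * n) := by
      rw [hδ, div_pow, mul_pow, sq_sqrt (by positivity), hs, one_pow]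
    have hδπ : δ ≤ π := by
      have h1 : δ ^ 2 ≤ 1 ^ 2 := by
        rw [hδsq, div_le_iff₀ (by positivity)]; nlinarith
      have := le_of_sq_le_sq h1 zero_le_one
      linarith [pi_gt_three]
    have h1 : ∫ t in (-π)..π, ((ψ t ^ n).re + B / s * exp (-(b * n) * t ^ 2)) =
        (∫ t in (-π)..π, (ψ t ^ n).re) + B / s * ∫ t in (-π)..π, exp (-(b * n) * t ^ 2) := by
      rw [intervalIntegral.integral_add (hψi _ _) ((hFi _ _).const_mul _),
        intervalIntegral.integral_const_mul]
    have h2 : ∫ t in (-δ)..δ, ((ψ t ^ n).re + B / s * exp (-(b * n) * t ^ 2)) ≤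
        ∫ t in (-π)..π, ((ψ t ^ n).re + B / s * exp (-(b * n) * t ^ 2)) := by
      refine intervalIntegral.integral_mono_interval (by linarith) (by linarith) hδπ ?_
        ((hψi _ _).add ((hFi _ _).const_mul _))
      refine (MeasureTheory.ae_restrict_iff' measurableSet_Ioc).2
        (Filter.Eventually.of_forall fun t ht => le_trans ?_ (hlower t (habs t ⟨ht.1.le, ht.2⟩)))
      split_ifs with h
      · exact pow_nonneg (by linarith) n
      · exact le_rfl
    have h3 : ∫ t in (-δ)..δ, (1 / 2 : ℝ) ≤
        ∫ t in (-δ)..δ, ((ψ t ^ n).re + B / s * exp (-(b * n) * t ^ 2)) := by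
      refine intervalIntegral.integral_mono_on (by linarith) (by simp)
        ((hψi _ _).add ((hFi _ _).const_mul _)) fun t ht => ?_
      have htδ : t ^ 2 ≤ δ ^ 2 := sq_le_sq' ht.1 ht.2
      have hKt : K * t ^ 2 * n ≤ 1 / 2 := by
        rw [hδsq] at htδ
        calc K * t ^ 2 * n ≤ K * (1 / (2 * K * n)) * n := by gcongr
          _ = 1 / 2 := by field_simp
      have hKt' : K * t ^ 2 ≤ 1 := by
        have := le_mul_of_one_le_right (mul_nonneg hK0.le (sq_nonneg t))
          (one_le_two.trans hn2')
        linarith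
      have h := hlower t (abs_le.2 ⟨by linarith [ht.1], by linarith [ht.2]⟩)
      rw [if_pos hKt'] at h
      have hbern := one_add_mul_le_pow (a := -(K * t ^ 2)) (by linarith) n
      rw [← sub_eq_add_neg] at hbern
      have hcomm : (n : ℝ) * -(K * t ^ 2) = -(K * t ^ 2 * n) := by ring
      linarith
    have h4 : ∫ t in (-δ)..δ, (1 / 2 : ℝ) = δ := by
      rw [intervalIntegral.integral_const, smul_eq_mul]; ring
    have h5 : B / s * ∫ t in (-π)..π, exp (-(b * n) * t ^ 2) ≤ κ / s := by
      calc _ ≤ B / s * (G / s) := by gcongr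
        _ = (B * G) / s / s := by ring
        _ ≤ (κ * s) / s / s := by gcongr
        _ = κ / s := by field_simp
    have h6 : δ = 2 * (κ / s) := by rw [hδ, hκ]; field_simp
    linarith
  refine ⟨lt_of_lt_of_le (by positivity) hI, hJ.trans ?_⟩
  calc D / n * (G / s) = D * G / κ / n * (κ / s) := by field_simp
    _ ≤ _ := by gcongr

theorem coeff_mk_pow_nonneg {p : ℕ → ℝ} (h0 : ∀ k, 0 ≤ p k) (L n : ℕ) :
    0 ≤ PowerSeries.coeff n (PowerSeries.mk p ^ L) := by
  induction L generalizing n with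
  | zero => rw [pow_zero, PowerSeries.coeff_one]; split_ifs <;> norm_num
  | succ L ih =>
    rw [pow_succ, PowerSeries.coeff_mul]
    exact sum_nonneg fun i _ => mul_nonneg (ih _) (by simpa using h0 _)

theorem summable_coeff_mk_pow {p : ℕ → ℝ} (h0 : ∀ k, 0 ≤ p k) (hs : Summable p) (L : ℕ) :
    Summable fun n => PowerSeries.coeff n (PowerSeries.mk p ^ L) := by
  induction L with
  | zero =>
    refine summable_of_ne_finset_zero (s := {0}) fun n hn => ?_
    rw [pow_zero, PowerSeries.coeff_one, if_neg (by simpa using hn)]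
  | succ L ih =>
    simp only [pow_succ, PowerSeries.coeff_mul, PowerSeries.coeff_mk]
    exact summable_sum_mul_antidiagonal_of_summable_mul
      (f := fun n => PowerSeries.coeff n (PowerSeries.mk p ^ L)) (g := p)
      (ih.mul_of_nonneg hs (fun n => coeff_mk_pow_nonneg h0 L n) (fun k => h0 k))

theorem tsum_coeff_mk_pow_mul_pow {p : ℕ → ℝ} (h0 : ∀ k, 0 ≤ p k) (hs : Summable p) {z : ℂ}
    (hz : ‖z‖ = 1) (L : ℕ) :
    ∑' n, ((PowerSeries.coeff n (PowerSeries.mk p ^ L) : ℝ) : ℂ) * z ^ n =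
      (∑' k, (p k : ℂ) * z ^ k) ^ L := by
  have hnorm : ∀ (q : ℕ → ℝ), (∀ k, 0 ≤ q k) → Summable q →
      Summable fun k => ‖(q k : ℂ) * z ^ k‖ := fun q hq hqs => by
    simpa [hz, abs_of_nonneg (hq _)] using hqs
  induction L with
  | zero =>
    rw [tsum_eq_single 0 fun n hn => by simp [PowerSeries.coeff_one, hn]]
    simp
  | succ L ih =>
    rw [pow_succ (∑' k, (p k : ℂ) * z ^ k), ← ih, tsum_mul_tsum_eq_tsum_sum_antidiagonal_of_summable_norm
      (hnorm _ (coeff_mk_pow_nonneg h0 L) (summable_coeff_mk_pow h0 hs L)) (hnorm p h0 hs)]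
    refine tsum_congr fun n => ?_
    rw [pow_succ, PowerSeries.coeff_mul]
    push_cast
    rw [sum_mul]
    refine sum_congr rfl fun i hi => ?_
    rw [PowerSeries.coeff_mk, ← mem_antidiagonal.1 hi, pow_add]
    ring

/-- The characteristic function at `t` of the distribution `p` on `ℕ` translated by `-m`. -/
noncomputable def centredCharFun (p : ℕ → ℝ) (m t : ℝ) : ℂ :=
  ∑' k : ℕ, (p k : ℂ) * Complex.exp (((k - m) * t : ℝ) * Complex.I)

theorem norm_centredCharFun_term {p : ℕ → ℝ} (h0 : ∀ k, 0 ≤ p k) (m t : ℝ) (k : ℕ) :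
    ‖(p k : ℂ) * Complex.exp (((k - m) * t : ℝ) * Complex.I)‖ = p k := by
  rw [norm_mul, Complex.norm_exp_ofReal_mul_I, mul_one, Complex.norm_real, norm_of_nonneg (h0 k)]

theorem summable_centredCharFun {p : ℕ → ℝ} (h0 : ∀ k, 0 ≤ p k) (hs : Summable p) (m t : ℝ) :
    Summable fun k : ℕ => (p k : ℂ) * Complex.exp (((k - m) * t : ℝ) * Complex.I) :=
  Summable.of_norm (by simpa only [norm_centredCharFun_term h0] using hs)

theorem continuous_centredCharFun {p : ℕ → ℝ} (h0 : ∀ k, 0 ≤ p k) (hs : Summable p) (m : ℝ) :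
    Continuous (centredCharFun p m) :=
  continuous_tsum (fun k => by fun_prop) hs fun k t => (norm_centredCharFun_term h0 m t k).le

theorem centredCharFun_eq (p : ℕ → ℝ) (m t : ℝ) :
    centredCharFun p m t = (∑' k : ℕ, (p k : ℂ) * Complex.exp (t * Complex.I) ^ k) *
      Complex.exp (-(m * t : ℝ) * Complex.I) := by
  rw [centredCharFun, ← tsum_mul_right]
  refine tsum_congr fun k => ?_
  rw [mul_assoc, ← Complex.exp_nat_mul, ← Complex.exp_add]
  push_cast
  ring_nf

theorem re_centredCharFun {p : ℕ → ℝ} (h0 : ∀ k, 0 ≤ p k) (hs : Summable p) (m t : ℝ) :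
    HasSum (fun k : ℕ => p k * cos ((k - m) * t)) (centredCharFun p m t).re := by
  have h := Complex.hasSum_re (summable_centredCharFun h0 hs m t).hasSum
  simp only [Complex.re_ofReal_mul, Complex.exp_ofReal_mul_I_re] at h
  exact h

theorem im_centredCharFun {p : ℕ → ℝ} (h0 : ∀ k, 0 ≤ p k) (hs : Summable p) (m t : ℝ) :
    HasSum (fun k : ℕ => p k * sin ((k - m) * t)) (centredCharFun p m t).im := by
  have h := Complex.hasSum_im (summable_centredCharFun h0 hs m t).hasSum
  simp only [Complex.im_ofReal_mul, Complex.exp_ofReal_mul_I_im] at h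
  exact h

theorem integral_exp_int_mul_I (j : ℤ) :
    ∫ t in (-π)..π, Complex.exp ((j * t : ℝ) * Complex.I) = if j = 0 then (2 * π : ℂ) else 0 := by
  split_ifs with h
  · simp only [h, Int.cast_zero, zero_mul, Complex.ofReal_zero, Complex.exp_zero,
      intervalIntegral.integral_const, Complex.real_smul]
    push_cast
    ring
  · have hj : (j : ℂ) * Complex.I ≠ 0 := by simpa using h
    have h1 := integral_exp_mul_complex (a := -π) (b := π) hj
    have h2 : Complex.exp (j * Complex.I * π) = Complex.exp (j * Complex.I * (-π : ℝ)) := by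
      rw [Complex.exp_eq_exp_iff_exists_int]
      exact ⟨j, by push_cast; ring⟩
    rw [h2, sub_self, zero_div] at h1
    rw [← h1]
    refine intervalIntegral.integral_congr fun t _ => ?_
    congr 1
    push_cast
    ring

/-- Fourier inversion for the `L`-fold convolution power of `p`. -/
theorem integral_centredCharFun_pow_mul_exp {p : ℕ → ℝ} (h0 : ∀ k, 0 ≤ p k) (hs : Summable p)
    {m : ℝ} {L M : ℕ} (hM : L * m = M) (n : ℕ) :
    ∫ t in (-π)..π, centredCharFun p m t ^ L * Complex.exp (((M - n : ℝ) * t : ℝ) * Complex.I) =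
      2 * π * ((PowerSeries.coeff n (PowerSeries.mk p ^ L) : ℝ) : ℂ) := by
  set q : ℕ → ℝ := fun k => PowerSeries.coeff k (PowerSeries.mk p ^ L) with hq
  have hq0 : ∀ k, 0 ≤ q k := coeff_mk_pow_nonneg h0 L
  have hqs : Summable q := summable_coeff_mk_pow h0 hs L
  have hexpand : ∀ t : ℝ, centredCharFun p m t ^ L *
      Complex.exp (((M - n : ℝ) * t : ℝ) * Complex.I) =
      ∑' k : ℕ, (q k : ℂ) * Complex.exp ((((k : ℤ) - (n : ℤ) : ℤ) * t : ℝ) * Complex.I) := by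
    intro t
    rw [centredCharFun_eq, mul_pow, ← tsum_coeff_mk_pow_mul_pow h0 hs
      (Complex.norm_exp_ofReal_mul_I t), mul_assoc, ← tsum_mul_right]
    refine tsum_congr fun k => ?_
    change (q k : ℂ) * _ * _ = _
    rw [mul_assoc, ← Complex.exp_nat_mul, ← Complex.exp_nat_mul, ← Complex.exp_add,
      ← Complex.exp_add, ← hM]
    push_cast
    ring_nf
  have hsum := intervalIntegral.hasSum_integral_of_dominated_convergence (a := -π) (b := π)
    (μ := MeasureTheory.volume)
    (F := fun (k : ℕ) (t : ℝ) =>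
      (q k : ℂ) * Complex.exp ((((k : ℤ) - (n : ℤ) : ℤ) * t : ℝ) * Complex.I))
    (f := fun t : ℝ => ∑' k : ℕ,
      (q k : ℂ) * Complex.exp ((((k : ℤ) - (n : ℤ) : ℤ) * t : ℝ) * Complex.I))
    (fun k _ => q k)
    (fun k => Continuous.aestronglyMeasurable (by fun_prop))
    (fun k => Filter.Eventually.of_forall fun t _ => by
      rw [norm_mul, Complex.norm_exp_ofReal_mul_I, mul_one, Complex.norm_real,
        norm_of_nonneg (hq0 k)])
    (Filter.Eventually.of_forall fun t _ => hqs)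
    (by simp)
    (Filter.Eventually.of_forall fun t _ => by
      refine (Summable.of_norm ?_).hasSum
      simpa only [norm_mul, Complex.norm_exp_ofReal_mul_I, mul_one, Complex.norm_real,
        norm_of_nonneg (hq0 _)] using hqs)
  simp only [hexpand]
  rw [← hsum.tsum_eq, tsum_eq_single n]
  · rw [intervalIntegral.integral_const_mul, integral_exp_int_mul_I, if_pos (sub_self _), mul_comm]
  · intro k hk
    rw [intervalIntegral.integral_const_mul, integral_exp_int_mul_I, if_neg, mul_zero]
    omega

theorem norm_centredCharFun_le {p : ℕ → ℝ} (h0 : ∀ k, 0 ≤ p k) (hs : HasSum p 1) (m : ℝ) {t : ℝ}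
    (ht : |t| ≤ π) :
    ‖centredCharFun p m t‖ ≤ exp (-(2 / π ^ 2 * (p 0 * p 1)) * t ^ 2) := by
  have hsum := summable_centredCharFun h0 hs.summable m t
  have htail := hs.summable.sum_add_tsum_nat_add 2
  rw [hs.tsum_eq, sum_range_succ, sum_range_one] at htail
  have htail0 : 0 ≤ ∑' k, p (k + 2) := tsum_nonneg fun k => h0 _
  have h01 : p 0 + p 1 ≤ 1 := by linarith
  have hp := mul_nonneg (h0 0) (h0 1)
  have hcos := cos_le_one_sub_mul_cos_sq ht
  have hcos1 := cos_le_one t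
  -- the contribution of the two sites `0` and `1`
  set w : ℂ := (p 0 : ℂ) * Complex.exp ((((0 : ℕ) - m) * t : ℝ) * Complex.I) +
    (p 1 : ℂ) * Complex.exp ((((1 : ℕ) - m) * t : ℝ) * Complex.I) with hw
  have hwsq : ‖w‖ ^ 2 = (p 0 + p 1) ^ 2 - 2 * (p 0 * p 1) * (1 - cos t) := by
    have hfac : w = Complex.exp (((-m) * t : ℝ) * Complex.I) *
        (p 0 + p 1 * Complex.exp (t * Complex.I)) := by
      rw [hw, mul_add, mul_left_comm _ (p 1 : ℂ), ← Complex.exp_add, mul_comm _ (p 0 : ℂ)]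
      push_cast
      ring_nf
    rw [hfac, norm_mul, Complex.norm_exp_ofReal_mul_I, one_mul, Complex.sq_norm,
      Complex.normSq_apply]
    simp only [Complex.add_re, Complex.add_im, Complex.re_ofReal_mul, Complex.im_ofReal_mul,
      Complex.ofReal_re, Complex.ofReal_im, Complex.exp_ofReal_mul_I_re,
      Complex.exp_ofReal_mul_I_im]
    linear_combination (p 1) ^ 2 * (sin_sq_add_cos_sq t)
  have hwle : ‖w‖ ≤ (p 0 + p 1) - p 0 * p 1 * (1 - cos t) := by
    have hy : p 0 * p 1 * (1 - cos t) ≤ p 0 + p 1 := by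
      have h2 : 1 - cos t ≤ 2 := by linarith [neg_one_le_cos t]
      nlinarith [mul_le_mul_of_nonneg_left h2 hp, h0 0, h0 1]
    refine le_of_sq_le_sq ?_ (by linarith)
    rw [hwsq]
    nlinarith [mul_nonneg hp (sub_nonneg.2 hcos1), sq_nonneg (p 0 * p 1 * (1 - cos t)),
      mul_nonneg (mul_nonneg hp (sub_nonneg.2 hcos1)) (sub_nonneg.2 h01)]
  have hmain : ‖centredCharFun p m t‖ ≤ 1 - p 0 * p 1 * (1 - cos t) := by
    rw [centredCharFun, ← hsum.sum_add_tsum_nat_add 2, sum_range_succ, sum_range_one]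
    refine (norm_add_le _ _).trans ?_
    have h2 := tsum_of_norm_bounded ((summable_nat_add_iff 2).2 hs.summable).hasSum
      fun k => (norm_centredCharFun_term h0 m t (k + 2)).le
    linarith
  refine hmain.trans (le_trans ?_ (add_one_le_exp _))
  nlinarith [mul_le_mul_of_nonneg_left hcos hp]

theorem abs_sin_sub_le (y : ℝ) : |sin y - y| ≤ 2 * |y| ^ 3 := by
  wlog hy : 0 ≤ y generalizing y
  · have := this (-y) (by linarith)
    rwa [sin_neg, abs_neg, ← neg_sub_neg, neg_neg, abs_sub_comm, neg_neg] at this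
  rcases hy.eq_or_lt with rfl | hy
  · simp
  have h1 := sin_gt_sub_cube hy
  have h2 := sin_le hy.le
  rw [abs_of_nonpos (by linarith), abs_of_pos hy]
  nlinarith [pow_pos hy 3]

theorem abs_im_centredCharFun_le {p : ℕ → ℝ} (h0 : ∀ k, 0 ≤ p k) (hs : HasSum p 1) {m T : ℝ}
    (hm : HasSum (fun k : ℕ => k * p k) m) (hT : HasSum (fun k : ℕ => |k - m| ^ 3 * p k) T)
    (t : ℝ) : |(centredCharFun p m t).im| ≤ 2 * T * |t| ^ 3 := by
  have h1 : HasSum (fun k : ℕ => p k * ((k - m) * t)) 0 := by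
    have h := (hm.sub (hs.mul_left m)).mul_right t
    rw [mul_one, sub_self, zero_mul] at h
    exact h.congr_fun fun k => by ring
  have h2 := (im_centredCharFun h0 hs.summable m t).sub h1
  rw [sub_zero] at h2
  rw [← h2.tsum_eq, ← norm_eq_abs]
  refine tsum_of_norm_bounded ((hT.mul_left 2).mul_right (|t| ^ 3)) fun k => ?_
  rw [← mul_sub, norm_mul, norm_of_nonneg (h0 k), norm_eq_abs]
  calc p k * |sin ((k - m) * t) - (k - m) * t| ≤ p k * (2 * |(k - m) * t| ^ 3) :=
        mul_le_mul_of_nonneg_left (abs_sin_sub_le _) (h0 k)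
    _ = _ := by rw [abs_mul]; ring

theorem le_re_centredCharFun {p : ℕ → ℝ} (h0 : ∀ k, 0 ≤ p k) (hs : HasSum p 1) {m K : ℝ}
    (hK : HasSum (fun k : ℕ => (k - m) ^ 2 * p k) K) (t : ℝ) :
    1 - K * t ^ 2 ≤ (centredCharFun p m t).re := by
  refine hasSum_le (fun k => ?_) (hs.sub (hK.mul_right (t ^ 2)))
    (re_centredCharFun h0 hs.summable m t)
  nlinarith [one_sub_sq_div_two_le_cos (x := (k - m) * t), h0 k, mul_nonneg (h0 k)
    (sq_nonneg ((k - m) * t)), mul_le_mul_of_nonneg_left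
    (one_sub_sq_div_two_le_cos (x := (k - m) * t)) (h0 k)]

/-- A quantitative local limit statement: for the `n`-th convolution power of a law on `ℕ` with
mean `M / n`, neighbouring probabilities at `M` agree up to a relative error `O(1 / n)`, uniformly
over laws with bounded moments and non-degenerate mass on `{0, 1}`. -/
theorem exists_coeff_pow_ratio_bound {c A : ℝ} (hc : 0 < c) (hA : 1 ≤ A) :
    ∃ C > 0, ∃ N : ℕ, ∀ n : ℕ, N ≤ n → ∀ (p : ℕ → ℝ) (m : ℝ) (M : ℕ), (∀ k, 0 ≤ p k) →
      HasSum p 1 → HasSum (fun k : ℕ => k * p k) m → n * m = (M + 1 : ℕ) → c ≤ p 0 * p 1 →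
      (∀ K, HasSum (fun k : ℕ => (k - m) ^ 2 * p k) K → K ≤ A) →
      (∀ T, HasSum (fun k : ℕ => |k - m| ^ 3 * p k) T → T ≤ A) →
      (Summable fun k : ℕ => (k - m) ^ 2 * p k) → (Summable fun k : ℕ => |k - m| ^ 3 * p k) →
      |PowerSeries.coeff M (PowerSeries.mk p ^ n) /
        PowerSeries.coeff (M + 1) (PowerSeries.mk p ^ n) - 1| ≤ C / n := by
  obtain ⟨C, hC, N, h⟩ := exists_fourier_integral_ratio_bound
    (c := 2 / π ^ 2 * c) (T := 2 * A) (K := A) (by positivity) (by linarith) hA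
  refine ⟨C, hC, N, fun n hn p m M h0 hs hm hM hp hK hT hKs hTs => ?_⟩
  have hcont := continuous_centredCharFun h0 hs.summable m
  obtain ⟨hpos, hle⟩ := h n hn (centredCharFun p m) hcont
    (fun t ht => (norm_centredCharFun_le h0 hs m ht).trans (by gcongr))
    (fun t _ => (abs_im_centredCharFun_le h0 hs hm hTs.hasSum t).trans (by
      gcongr; exact hT _ hTs.hasSum))
    (fun t _ => le_trans (by gcongr; exact hK _ hKs.hasSum)
      (le_re_centredCharFun h0 hs hKs.hasSum t))
  set P : ℕ → ℝ := fun k => PowerSeries.coeff k (PowerSeries.mk p ^ n) with hP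
  have hI1 : ∫ t in (-π)..π, centredCharFun p m t ^ n = 2 * π * (P (M + 1) : ℂ) := by
    rw [hP, ← integral_centredCharFun_pow_mul_exp h0 hs.summable hM (M + 1)]
    simp
  have hI2 : ∫ t in (-π)..π, centredCharFun p m t ^ n * Complex.exp (t * Complex.I) =
      2 * π * (P M : ℂ) := by
    rw [hP, ← integral_centredCharFun_pow_mul_exp h0 hs.summable hM M]
    simp
  have hre : ∀ f : ℝ → ℂ, Continuous f →
      ∫ t in (-π)..π, (f t).re = (∫ t in (-π)..π, f t).re := fun f hf =>
    Complex.reCLM.intervalIntegral_comp_comm (hf.intervalIntegrable _ _)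
  have hR1 : ∫ t in (-π)..π, (centredCharFun p m t ^ n).re = 2 * π * P (M + 1) := by
    rw [hre _ (by fun_prop), hI1]
    norm_cast
  have hR2 : ∫ t in (-π)..π,
      (centredCharFun p m t ^ n * (1 - Complex.exp (t * Complex.I))).re =
      2 * π * (P (M + 1) - P M) := by
    rw [hre _ (by fun_prop)]
    simp only [mul_sub, mul_one]
    rw [intervalIntegral.integral_sub, hI1, hI2]
    · norm_cast
    · exact Continuous.intervalIntegrable (by fun_prop) _ _
    · exact Continuous.intervalIntegrable (by fun_prop) _ _
  rw [hR1] at hpos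
  rw [hR1, hR2, abs_mul, abs_of_pos two_pi_pos, mul_left_comm] at hle
  have hPpos : 0 < P (M + 1) := pos_of_mul_pos_right hpos two_pi_pos.le
  have hle' := le_of_mul_le_mul_left hle two_pi_pos
  change |P M / P (M + 1) - 1| ≤ C / n
  rw [div_sub_one hPpos.ne', abs_div, abs_of_pos hPpos, div_le_iff₀ hPpos, abs_sub_comm]
  exact hle'

theorem gFact_pos {g : ℕ → ℝ} (hgpos : ∀ k : ℕ, 0 < k → 0 < g k) (k : ℕ) : 0 < gFact g k := by
  induction k with
  | zero => exact one_pos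
  | succ k ih => exact mul_pos ih (hgpos _ k.succ_pos)

theorem GapCondition.tendsto_atTop {g : ℕ → ℝ} (hg0 : g 0 = 0) (hgmono : Monotone g)
    (hgap : GapCondition g) : Filter.Tendsto g Filter.atTop Filter.atTop := by
  obtain ⟨n₀, cg, hcg, h⟩ := hgap
  have hmul : ∀ j : ℕ, j * cg ≤ g (j * n₀) := by
    intro j
    induction j with
    | zero => simp [hg0]
    | succ j ih =>
      have := h (j * n₀) ((j + 1) * n₀) (by rw [add_mul, one_mul])
      push_cast
      linarith
  refine Filter.tendsto_atTop_atTop_of_monotone hgmono fun b => ?_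
  obtain ⟨j, hj⟩ := exists_nat_ge (b / cg)
  exact ⟨j * n₀, ((div_le_iff₀ hcg).1 hj).trans (hmul j)⟩

theorem summable_pow_div_gFact {g : ℕ → ℝ} (hgpos : ∀ k : ℕ, 0 < k → 0 < g k)
    (hg : Filter.Tendsto g Filter.atTop Filter.atTop) {l : ℝ} (hl : 0 < l) :
    Summable fun k : ℕ => l ^ k / gFact g k := by
  have hpos := gFact_pos hgpos
  refine summable_of_ratio_test_tendsto_lt_one zero_lt_one
    (Filter.Eventually.of_forall fun k => (div_pos (pow_pos hl k) (hpos k)).ne') ?_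
  refine (((Filter.tendsto_add_atTop_iff_nat 1).2 hg).const_div_atTop l).congr fun k => ?_
  rw [norm_of_nonneg (div_pos (pow_pos hl _) (hpos _)).le,
    norm_of_nonneg (div_pos (pow_pos hl _) (hpos _)).le, gFact]
  have h1 := (hpos k).ne'
  have h2 := (hgpos (k + 1) k.succ_pos).ne'
  rw [pow_succ]
  field_simp

theorem succ_pow_three_le (k : ℕ) : ((k : ℝ) + 1) ^ 3 ≤ 8 ^ k := by
  have h : (k : ℝ) + 1 ≤ 2 ^ k := by exact_mod_cast Nat.lt_two_pow_self
  calc ((k : ℝ) + 1) ^ 3 ≤ (2 ^ k) ^ 3 := by gcongr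
    _ = 8 ^ k := by rw [← pow_mul, mul_comm, pow_mul]; norm_num

theorem coeff_mk_nWeight_pow (g : ℕ → ℝ) (l : ℝ) (L n : ℕ) :
    PowerSeries.coeff n (PowerSeries.mk (nWeight g l) ^ L) = ((Zfun g l)⁻¹ ^ L * l ^ n) *
      PowerSeries.coeff n (PowerSeries.mk (fun k => (gFact g k)⁻¹) ^ L) := by
  have h : PowerSeries.mk (nWeight g l) = PowerSeries.C (Zfun g l)⁻¹ *
      PowerSeries.rescale l (PowerSeries.mk fun k => (gFact g k)⁻¹) := by
    ext k
    rw [PowerSeries.coeff_C_mul, PowerSeries.coeff_rescale, PowerSeries.coeff_mk,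
      PowerSeries.coeff_mk, nWeight, div_eq_mul_inv, mul_inv]
    ring
  rw [h, mul_pow, ← map_pow, ← map_pow, PowerSeries.coeff_C_mul, PowerSeries.coeff_rescale,
    mul_assoc]

theorem sum_prod_inv_gFact {Λ : Type*} [Fintype Λ] [DecidableEq Λ] (g : ℕ → ℝ) (M : ℕ) :
    ∑ η ∈ finsuppAntidiag (univ : Finset Λ) M, ∏ y : Λ, (gFact g (η y))⁻¹ =
      PowerSeries.coeff M (PowerSeries.mk (fun k => (gFact g k)⁻¹) ^ Fintype.card Λ) := by
  rw [← card_univ, ← prod_const, PowerSeries.coeff_prod]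
  simp only [PowerSeries.coeff_mk]

theorem sum_apply_mul_prod_inv_gFact {Λ : Type*} [Fintype Λ] [DecidableEq Λ] {g : ℕ → ℝ}
    (hg0 : g 0 = 0) (hgpos : ∀ k : ℕ, 0 < k → 0 < g k) (y₀ : Λ) (M : ℕ) :
    ∑ η ∈ finsuppAntidiag (univ : Finset Λ) (M + 1), g (η y₀) * ∏ y : Λ, (gFact g (η y))⁻¹ =
      PowerSeries.coeff M (PowerSeries.mk (fun k => (gFact g k)⁻¹) ^ Fintype.card Λ) := by
  set w : PowerSeries ℝ := PowerSeries.mk fun k => (gFact g k)⁻¹ with hw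
  have hX : ∀ k, PowerSeries.coeff k (PowerSeries.X * w) = g k * (gFact g k)⁻¹ := by
    intro k
    cases k with
    | zero => simp [hg0]
    | succ k =>
      have h1 := (hgpos (k + 1) k.succ_pos).ne'
      have h2 := (gFact_pos hgpos k).ne'
      rw [PowerSeries.coeff_succ_X_mul, hw, PowerSeries.coeff_mk, gFact]
      field_simp
  have hprod : PowerSeries.X * w ^ Fintype.card Λ =
      ∏ y : Λ, if y = y₀ then PowerSeries.X * w else w := by
    rw [← card_univ, ← prod_const, ← mul_prod_erase univ _ (mem_univ y₀),
      ← mul_prod_erase univ (fun y => if y = y₀ then PowerSeries.X * w else w) (mem_univ y₀),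
      if_pos rfl, mul_assoc]
    congr 2
    exact prod_congr rfl fun y hy => (if_neg (ne_of_mem_erase hy)).symm
  rw [← PowerSeries.coeff_succ_X_mul, hprod, PowerSeries.coeff_prod]
  refine sum_congr rfl fun η _ => ?_
  rw [← mul_prod_erase univ _ (mem_univ y₀), ← mul_prod_erase univ (fun y =>
    PowerSeries.coeff (η y) (if y = y₀ then PowerSeries.X * w else w)) (mem_univ y₀),
    if_pos rfl, hX, mul_assoc]
  congr 2
  exact prod_congr rfl fun y hy => by rw [if_neg (ne_of_mem_erase hy), hw, PowerSeries.coeff_mk]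

theorem le_mul_natCast_of_lipschitz {g : ℕ → ℝ} (hg0 : g 0 = 0) {g₂ : ℝ}
    (hglip : ∀ k : ℕ, |g (k + 1) - g k| ≤ g₂) (k : ℕ) : g k ≤ g₂ * k := by
  induction k with
  | zero => simp [hg0]
  | succ k ih =>
    have := (le_abs_self _).trans (hglip k)
    push_cast
    linarith

theorem canonical_mean_nonneg_and_le {Λ : Type*} [Fintype Λ] [DecidableEq Λ] {g : ℕ → ℝ}
    (hg0 : g 0 = 0) (hgpos : ∀ k : ℕ, 0 < k → 0 < g k) {g₂ : ℝ} (hg₂ : 0 ≤ g₂)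
    (hglip : ∀ k : ℕ, |g (k + 1) - g k| ≤ g₂) (y₀ : Λ) (M : ℕ) :
    0 ≤ (∑ η ∈ finsuppAntidiag (univ : Finset Λ) M, g (η y₀) * ∏ y : Λ, (gFact g (η y))⁻¹) /
        (∑ η ∈ finsuppAntidiag (univ : Finset Λ) M, ∏ y : Λ, (gFact g (η y))⁻¹) ∧
      (∑ η ∈ finsuppAntidiag (univ : Finset Λ) M, g (η y₀) * ∏ y : Λ, (gFact g (η y))⁻¹) /
        (∑ η ∈ finsuppAntidiag (univ : Finset Λ) M, ∏ y : Λ, (gFact g (η y))⁻¹) ≤ g₂ * M := by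
  have hw : ∀ η : Λ →₀ ℕ, 0 ≤ ∏ y : Λ, (gFact g (η y))⁻¹ := fun η =>
    prod_nonneg fun y _ => (inv_pos.2 (gFact_pos hgpos _)).le
  have hden := sum_nonneg fun η (_ : η ∈ finsuppAntidiag (univ : Finset Λ) M) => hw η
  have hg : ∀ k, 0 ≤ g k := fun k => by
    rcases k.eq_zero_or_pos with rfl | hk
    exacts [hg0.ge, (hgpos k hk).le]
  refine ⟨div_nonneg (sum_nonneg fun η _ => mul_nonneg (hg _) (hw η)) hden,
    div_le_of_le_mul₀ hden (by positivity) ?_⟩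
  rw [mul_sum]
  refine sum_le_sum fun η hη => mul_le_mul_of_nonneg_right ?_ (hw η)
  refine (le_mul_natCast_of_lipschitz hg0 hglip _).trans ?_
  have : η y₀ ≤ M := by
    rw [← (mem_finsuppAntidiag.1 hη).1]
    exact single_le_sum (fun _ _ => Nat.zero_le _) (mem_univ y₀)
  gcongr

theorem one_le_Zfun {g : ℕ → ℝ} (hgpos : ∀ k : ℕ, 0 < k → 0 < g k)
    (hg : Filter.Tendsto g Filter.atTop Filter.atTop) {l : ℝ} (hl : 0 < l) : 1 ≤ Zfun g l := by
  have h := (summable_pow_div_gFact hgpos hg hl).le_tsum 0 fun k _ =>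
    (div_pos (pow_pos hl k) (gFact_pos hgpos k)).le
  rw [pow_zero, gFact, div_one] at h
  exact h

theorem Zfun_mono {g : ℕ → ℝ} (hgpos : ∀ k : ℕ, 0 < k → 0 < g k)
    (hg : Filter.Tendsto g Filter.atTop Filter.atTop) {l l' : ℝ} (hl : 0 < l) (hl' : l ≤ l') :
    Zfun g l ≤ Zfun g l' :=
  (summable_pow_div_gFact hgpos hg hl).tsum_le_tsum
    (fun k => by have := gFact_pos hgpos k; gcongr)
    (summable_pow_div_gFact hgpos hg (hl.trans_le hl'))

theorem nWeight_pos {g : ℕ → ℝ} (hgpos : ∀ k : ℕ, 0 < k → 0 < g k)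
    (hg : Filter.Tendsto g Filter.atTop Filter.atTop) {l : ℝ} (hl : 0 < l) (k : ℕ) :
    0 < nWeight g l k :=
  div_pos (pow_pos hl k) (mul_pos (gFact_pos hgpos k)
    (one_pos.trans_le (one_le_Zfun hgpos hg hl)))

theorem hasSum_nWeight {g : ℕ → ℝ} (hgpos : ∀ k : ℕ, 0 < k → 0 < g k)
    (hg : Filter.Tendsto g Filter.atTop Filter.atTop) {l : ℝ} (hl : 0 < l) :
    HasSum (nWeight g l) 1 := by
  have hZ : Zfun g l ≠ 0 := (one_pos.trans_le (one_le_Zfun hgpos hg hl)).ne'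
  have h := (summable_pow_div_gFact hgpos hg hl).hasSum.div_const (Zfun g l)
  change HasSum _ (Zfun g l / Zfun g l) at h
  rw [div_self hZ] at h
  exact h.congr_fun fun k => by rw [nWeight, div_div]

/-- Weights with at most cubic growth are summable against `nWeight g l`, with an explicit bound
that is monotone in the fugacity. -/
theorem summable_mul_nWeight_and_tsum_le {g : ℕ → ℝ} (hgpos : ∀ k : ℕ, 0 < k → 0 < g k)
    (hg : Filter.Tendsto g Filter.atTop Filter.atTop) {l l' : ℝ} (hl : 0 < l) (hl' : l ≤ l')
    {f : ℕ → ℝ} {D : ℝ} (hD : 0 ≤ D) (hf0 : ∀ k, 0 ≤ f k) (hf : ∀ k : ℕ, f k ≤ D * (k + 1) ^ 3) :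
    (Summable fun k => f k * nWeight g l k) ∧
      ∑' k, f k * nWeight g l k ≤ D * Zfun g (8 * l') := by
  have hs := (summable_pow_div_gFact hgpos hg (l := 8 * l') (by linarith)).mul_left D
  have hle : ∀ k, f k * nWeight g l k ≤ D * ((8 * l') ^ k / gFact g k) := fun k => by
    have hF := gFact_pos hgpos k
    have hZ := one_le_Zfun hgpos hg hl
    calc f k * nWeight g l k ≤ (D * 8 ^ k) * (l' ^ k / gFact g k) := by
          refine mul_le_mul ((hf k).trans ?_) ?_ (nWeight_pos hgpos hg hl k).le (by positivity)
          · gcongr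
            exact succ_pow_three_le k
          · rw [nWeight]
            exact div_le_div₀ (pow_nonneg (hl.le.trans hl') k) (by gcongr) hF (le_mul_of_one_le_right hF.le hZ)
      _ = _ := by rw [mul_pow]; ring
  have hsum : Summable fun k => f k * nWeight g l k :=
    hs.of_nonneg_of_le (fun k => mul_nonneg (hf0 k) (nWeight_pos hgpos hg hl k).le) hle
  refine ⟨hsum, (hsum.tsum_le_tsum hle hs).trans_eq ?_⟩
  rw [tsum_mul_left, Zfun]

theorem hasSum_natCast_mul_nWeight {g : ℕ → ℝ} (hgpos : ∀ k : ℕ, 0 < k → 0 < g k)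
    (hg : Filter.Tendsto g Filter.atTop Filter.atTop) {l : ℝ} (hl : 0 < l) :
    HasSum (fun k : ℕ => k * nWeight g l k) (Rfun g l) := by
  have h := (summable_mul_nWeight_and_tsum_le hgpos hg hl le_rfl zero_le_one
    (f := fun k : ℕ => (k : ℝ)) (fun k => by positivity)
    (fun k => by nlinarith [(k.cast_nonneg : (0 : ℝ) ≤ k), sq_nonneg (k : ℝ)])).1.hasSum
  have he : ∑' k : ℕ, (k : ℝ) * nWeight g l k = Rfun g l := by
    simp only [Rfun, nWeight, mul_div_assoc]
  rwa [he] at h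

theorem hasSum_apply_mul_nWeight {g : ℕ → ℝ} (hg0 : g 0 = 0) (hgpos : ∀ k : ℕ, 0 < k → 0 < g k)
    (hg : Filter.Tendsto g Filter.atTop Filter.atTop) {l : ℝ} (hl : 0 < l) :
    HasSum (fun k : ℕ => g k * nWeight g l k) l := by
  rw [← hasSum_nat_add_iff' 1]
  have h := (hasSum_nWeight hgpos hg hl).mul_left l
  simp only [mul_one] at h
  simp only [sum_range_one, hg0, zero_mul, sub_zero]
  refine h.congr_fun fun k => ?_
  have h1 := (hgpos (k + 1) k.succ_pos).ne'
  have h2 := (gFact_pos hgpos k).ne'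
  have h3 : Zfun g l ≠ 0 := (one_pos.trans_le (one_le_Zfun hgpos hg hl)).ne'
  rw [nWeight, nWeight, gFact, pow_succ]
  field_simp

theorem fugacity_le_mul_Rfun {g : ℕ → ℝ} (hg0 : g 0 = 0) (hgpos : ∀ k : ℕ, 0 < k → 0 < g k)
    (hg : Filter.Tendsto g Filter.atTop Filter.atTop) {g₂ : ℝ}
    (hglip : ∀ k : ℕ, |g (k + 1) - g k| ≤ g₂) {l : ℝ} (hl : 0 < l) : l ≤ g₂ * Rfun g l := by
  refine hasSum_le (fun k => ?_) (hasSum_apply_mul_nWeight hg0 hgpos hg hl)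
    ((hasSum_natCast_mul_nWeight hgpos hg hl).mul_left g₂)
  rw [← mul_assoc]
  exact mul_le_mul_of_nonneg_right (le_mul_natCast_of_lipschitz hg0 hglip k)
    (nWeight_pos hgpos hg hl k).le

theorem Rfun_le_fugacity_mul {g : ℕ → ℝ} (hgpos : ∀ k : ℕ, 0 < k → 0 < g k)
    (hg : Filter.Tendsto g Filter.atTop Filter.atTop) {l l' : ℝ} (hl : 0 < l) (hl' : l ≤ l')
    (h1 : 1 ≤ l') : Rfun g l ≤ l * Zfun g (8 * l') := by
  refine hasSum_le (fun k => ?_) (hasSum_natCast_mul_nWeight hgpos hg hl)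
    ((summable_pow_div_gFact hgpos hg (l := 8 * l') (by linarith)).hasSum.mul_left l)
  have hF := gFact_pos hgpos k
  have hZ := one_le_Zfun hgpos hg hl
  cases k with
  | zero => simp [gFact, hl.le]
  | succ k =>
    have h8 : ((k + 1 : ℕ) : ℝ) ≤ 8 ^ (k + 1) := by
      exact_mod_cast (Nat.lt_pow_self (by norm_num)).le
    calc ((k + 1 : ℕ) : ℝ) * nWeight g l (k + 1)
        ≤ 8 ^ (k + 1) * (l * l' ^ (k + 1) / gFact g (k + 1)) := by
          refine mul_le_mul h8 ?_ (nWeight_pos hgpos hg hl _).le (by positivity)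
          rw [nWeight]
          refine div_le_div₀ (by positivity) ?_ hF (le_mul_of_one_le_right hF.le hZ)
          rw [pow_succ' l]
          gcongr
          calc l ^ k ≤ l' ^ k := by gcongr
            _ ≤ l' ^ (k + 1) := pow_le_pow_right₀ h1 k.le_succ
      _ = _ := by rw [mul_pow]; ring

/-- Quantitative equivalence of ensembles: if `g` is nondecreasing, uniformly
Lipschitz, and satisfies the gap condition, then for all `0 < m₀ < m₁` and every `ε > 0` there is
`C > 0` such that for every finite box `Λ` of cardinality `L ≥ 1`, distinguished site `y₀ ∈ Λ`,
particle number `M` and `λ > 0` with `R(λ) = M/L ∈ [m₀, m₁]`, the canonical expectation of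
`g(η_{y₀})` is within `C L^{−1+ε}` of `λ`. -/
theorem zrp_equivalence_of_ensembles (g : ℕ → ℝ) (hg0 : g 0 = 0)
    (hgpos : ∀ k : ℕ, 0 < k → 0 < g k) (hgmono : Monotone g)
    (g₂ : ℝ) (hglip : ∀ k : ℕ, |g (k + 1) - g k| ≤ g₂)
    (hgap : GapCondition g)
    (m₀ m₁ : ℝ) (hm₀ : 0 < m₀) (hm : m₀ < m₁) :
    ∀ ε > (0:ℝ), ∃ C > (0:ℝ),
      ∀ (Λ : Type) (_ : Fintype Λ) (_ : DecidableEq Λ) (L : ℕ),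
        Fintype.card Λ = L → 1 ≤ L →
        ∀ (y₀ : Λ) (M : ℕ) (lam : ℝ), 0 < lam →
          Rfun g lam = (M : ℝ) / (L : ℝ) →
          m₀ ≤ (M : ℝ) / (L : ℝ) → (M : ℝ) / (L : ℝ) ≤ m₁ →
          |(∑ η ∈ Finset.finsuppAntidiag (Finset.univ : Finset Λ) M,
                g (η y₀) * ∏ y : Λ, (gFact g (η y))⁻¹) /
              (∑ η ∈ Finset.finsuppAntidiag (Finset.univ : Finset Λ) M,
                ∏ y : Λ, (gFact g (η y))⁻¹) - lam|
            ≤ C * (L : ℝ) ^ (-1 + ε) := by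
  intro ε hε
  have hg := hgap.tendsto_atTop hg0 hgmono
  have hg₂ : 0 ≤ g₂ := (abs_nonneg _).trans (hglip 0)
  have hg1 := hgpos 1 one_pos
  have hm₁ : 0 < m₁ := hm₀.trans hm
  set l₁ : ℝ := g₂ * m₁ + 1 with hl₁
  have hl₁1 : 1 ≤ l₁ := by have := mul_nonneg hg₂ hm₁.le; linarith
  have hl₁0 : 0 < l₁ := by linarith
  set Z₁ : ℝ := Zfun g (8 * l₁) with hZ₁
  have hZ₁1 : 1 ≤ Z₁ := one_le_Zfun hgpos hg (by linarith)
  have hZ₁0 : 0 < Z₁ := by linarith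
  set A : ℝ := (1 + m₁) ^ 3 * Z₁ with hA
  have hA1 : 1 ≤ A := one_le_mul_of_one_le_of_one_le (one_le_pow₀ (by linarith)) hZ₁1
  obtain ⟨C, hC, N, hmain⟩ := exists_coeff_pow_ratio_bound
    (c := m₀ / Z₁ / (g 1 * Z₁ ^ 2)) (A := A) (by positivity) hA1
  refine ⟨C * l₁ + (g₂ * (m₁ * N) + l₁) * N + 1, by positivity, ?_⟩
  intro Λ _ _ L hL hL1 y₀ M lam hlam hR hM₀ hM₁
  have hL0 : (0 : ℝ) < L := by exact_mod_cast hL1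
  have hlam₁ : lam ≤ l₁ := by
    have h := fugacity_le_mul_Rfun hg0 hgpos hg hglip hlam
    rw [hR] at h
    have := mul_le_mul_of_nonneg_left hM₁ hg₂
    linarith
  have hrpow : (L : ℝ)⁻¹ ≤ (L : ℝ) ^ (-1 + ε) := by
    rw [← rpow_neg_one]
    exact rpow_le_rpow_of_exponent_le (by exact_mod_cast hL1) (by linarith)
  have hrpow0 : 0 < (L : ℝ) ^ (-1 + ε) := by positivity
  rcases lt_or_ge L N with hLN | hLN
  · obtain ⟨hq0, hq⟩ := canonical_mean_nonneg_and_le hg0 hgpos hg₂ hglip y₀ M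
    set q := (∑ η ∈ finsuppAntidiag (univ : Finset Λ) M, g (η y₀) * ∏ y : Λ, (gFact g (η y))⁻¹) /
      (∑ η ∈ finsuppAntidiag (univ : Finset Λ) M, ∏ y : Λ, (gFact g (η y))⁻¹)
    have hLN' : (L : ℝ) ≤ N := by exact_mod_cast hLN.le
    have hMN : (M : ℝ) ≤ m₁ * N := by
      rw [div_le_iff₀ hL0] at hM₁
      exact hM₁.trans (by gcongr)
    have hqB : |q - lam| ≤ g₂ * (m₁ * N) + l₁ := by
      have : g₂ * M ≤ g₂ * (m₁ * N) := by gcongr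
      exact abs_le.2 ⟨by linarith, by linarith⟩
    have hone : 1 ≤ N * (L : ℝ) ^ (-1 + ε) :=
      calc (1 : ℝ) = L * (L : ℝ)⁻¹ := (mul_inv_cancel₀ hL0.ne').symm
        _ ≤ N * (L : ℝ) ^ (-1 + ε) := by gcongr
    calc |q - lam| ≤ (g₂ * (m₁ * N) + l₁) * 1 := by rwa [mul_one]
      _ ≤ (g₂ * (m₁ * N) + l₁) * (N * (L : ℝ) ^ (-1 + ε)) := by gcongr
      _ ≤ _ := by
        have : 0 ≤ (C * l₁ + 1) * (L : ℝ) ^ (-1 + ε) := by positivity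
        linarith
  · have hMpos : 0 < M := by
      rw [Nat.pos_iff_ne_zero]
      rintro rfl
      rw [Nat.cast_zero, zero_div] at hM₀
      linarith
    obtain ⟨M, rfl⟩ := Nat.exists_eq_succ_of_ne_zero hMpos.ne'
    set m : ℝ := Rfun g lam with hm_def
    have hm_nonneg : 0 ≤ m := by rw [hR]; positivity
    have hm_le : m ≤ m₁ := by rw [hR]; exact hM₁
    have hZ0 : 0 < Zfun g lam := one_pos.trans_le (one_le_Zfun hgpos hg hlam)
    have hZle : Zfun g lam ≤ Z₁ := Zfun_mono hgpos hg hlam (by linarith)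
    have habs : ∀ k : ℕ, |(k : ℝ) - m| ≤ (1 + m₁) * (k + 1) := fun k => by
      have hk : (0 : ℝ) ≤ k := k.cast_nonneg
      have hmk := mul_nonneg hm₁.le hk
      exact abs_le.2 ⟨by linarith, by linarith⟩
    have hmom2 := summable_mul_nWeight_and_tsum_le hgpos hg hlam hlam₁
      (f := fun k : ℕ => (k - m) ^ 2) (D := (1 + m₁) ^ 3) (by positivity)
      (fun k => sq_nonneg _) fun k => by
        have hk : (1 : ℝ) ≤ (1 + m₁) * (k + 1) :=
          one_le_mul_of_one_le_of_one_le (by linarith) (by linarith [(k.cast_nonneg : (0 : ℝ) ≤ k)])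
        rw [← sq_abs, ← mul_pow]
        exact (pow_le_pow_left₀ (abs_nonneg _) (habs k) 2).trans
          (pow_le_pow_right₀ hk (by norm_num))
    have hmom3 := summable_mul_nWeight_and_tsum_le hgpos hg hlam hlam₁
      (f := fun k : ℕ => |k - m| ^ 3) (D := (1 + m₁) ^ 3) (by positivity)
      (fun k => by positivity) fun k => by
        rw [← mul_pow]
        exact pow_le_pow_left₀ (abs_nonneg _) (habs k) 3
    have hp01 : m₀ / Z₁ / (g 1 * Z₁ ^ 2) ≤ nWeight g lam 0 * nWeight g lam 1 := by
      have hlow : m₀ / Z₁ ≤ lam := by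
        rw [div_le_iff₀ hZ₁0]
        exact (hM₀.trans_eq hR.symm).trans (Rfun_le_fugacity_mul hgpos hg hlam hlam₁ hl₁1)
      have he : nWeight g lam 0 * nWeight g lam 1 = lam / (g 1 * Zfun g lam ^ 2) := by
        simp only [nWeight, gFact, pow_zero, pow_one, one_mul, zero_add]
        field_simp
      rw [he]
      gcongr
    have hratio := hmain L hLN (nWeight g lam) m M (fun k => (nWeight_pos hgpos hg hlam k).le)
      (hasSum_nWeight hgpos hg hlam) (hasSum_natCast_mul_nWeight hgpos hg hlam)
      (by rw [hR]; field_simp) hp01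
      (fun K hK => hK.tsum_eq.symm.trans_le hmom2.2)
      (fun T hT => hT.tsum_eq.symm.trans_le hmom3.2) hmom2.1 hmom3.1
    rw [coeff_mk_nWeight_pow, coeff_mk_nWeight_pow] at hratio
    rw [sum_prod_inv_gFact, sum_apply_mul_prod_inv_gFact hg0 hgpos, hL]
    set W : ℕ → ℝ := fun k =>
      PowerSeries.coeff k (PowerSeries.mk (fun k => (gFact g k)⁻¹) ^ L) with hW
    change |(Zfun g lam)⁻¹ ^ L * lam ^ M * W M /
      ((Zfun g lam)⁻¹ ^ L * lam ^ (M + 1) * W (M + 1)) - 1| ≤ C / L at hratio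
    change |W M / W (M + 1) - lam| ≤ _
    have he : W M / W (M + 1) - lam = lam * ((Zfun g lam)⁻¹ ^ L * lam ^ M * W M /
        ((Zfun g lam)⁻¹ ^ L * lam ^ (M + 1) * W (M + 1)) - 1) := by
      have hx : (Zfun g lam)⁻¹ ^ L * lam ^ M ≠ 0 := by positivity
      rw [pow_succ, ← mul_assoc, mul_assoc _ lam, mul_div_mul_left _ _ hx, mul_sub, mul_one,
        mul_comm lam (W (M + 1)), ← div_div, mul_div_cancel₀ _ hlam.ne']
    rw [he, abs_mul, abs_of_pos hlam]
    calc lam * |_| ≤ l₁ * (C / L) := by gcongr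
      _ = C * l₁ * (L : ℝ)⁻¹ := by ring
      _ ≤ C * l₁ * (L : ℝ) ^ (-1 + ε) := by gcongr
      _ ≤ _ := by
        have : 0 ≤ ((g₂ * (m₁ * N) + l₁) * N + 1) * (L : ℝ) ^ (-1 + ε) := by positivity
        linarith
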